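/- arXiv:2008.00227 — 2 statements merged into one kernel-verified Lean document; each statement's English description precedes it below -/
import Mathlib

section
/- Let A be an n×n matrix over ℚ and let 1 ≤ k ≤ n. Then k! · J_k(A) = j_k(I_1, I_2, …, I_k), i.e. evaluating the Cauchy polynomial j_k at x_i = Tr(A^i) gives k! times the k-th prodeterminant of A. -/
open MvPolynomial

/-- The unique `ℚ`-linear derivation `δ` of `ℚ[x₁, x₂, …]` with `δ xₖ = k · xₖ₊₁`. -/
noncomputable def δ : Derivation ℚ (MvPolynomial ℕ ℚ) (MvPolynomial ℕ ℚ) :=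
  mkDerivation ℚ fun k => (k : MvPolynomial ℕ ℚ) * X (k + 1)

/-- The Cauchy polynomials: `j 1 = x₁` and `j (k+1) = x₁ · j k − δ (j k)`. -/
noncomputable def cauchyJ : ℕ → MvPolynomial ℕ ℚ
  | 0 => 1
  | k + 1 => X 1 * cauchyJ k - δ (cauchyJ k)

/-- The `k`-th prodeterminant of an `n × n` matrix: `(−1)^k` times the coefficient of
`λ^(n−k)` in the characteristic polynomial `det (λ·I − A)`. -/
noncomputable def prodet {n : ℕ} (A : Matrix (Fin n) (Fin n) ℚ) (k : ℕ) : ℚ :=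
  (-1) ^ k * A.charpoly.coeff (n - k)

namespace Matrix

open scoped Polynomial

/-- **Jacobi's formula** for the derivative of the determinant of a polynomial matrix. -/
theorem derivative_det_eq_trace {m R : Type*} [Fintype m] [DecidableEq m] [CommRing R]
    (M : Matrix m m R[X]) :
    Polynomial.derivative M.det = (M.adjugate * M.map Polynomial.derivative).trace := by
  have h_entry (i : m) : (M.adjugate * M.map Polynomial.derivative) i i =
      (M.updateCol i fun j => Polynomial.derivative (M j i)).det := by
    rw [← cramer_apply, cramer_eq_adjugate_mulVec]
    rfl
  simp only [trace, diag_apply, h_entry, det_apply, Polynomial.derivative_sum]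
  rw [Finset.sum_comm]
  refine Finset.sum_congr rfl fun σ _ => ?_
  rw [← Finset.smul_sum, Polynomial.derivative_smul, Polynomial.derivative_prod_finset]
  congr 1
  refine Finset.sum_congr rfl fun i _ => ?_
  rw [← Finset.prod_erase_mul _ _ (Finset.mem_univ i), updateCol_self]
  congr 1
  refine Finset.prod_congr rfl fun j hj => ?_
  rw [updateCol_ne (Finset.ne_of_mem_erase hj)]

theorem map_coeff_adjugate_one_sub_X_smul {m R : Type*} [Fintype m] [DecidableEq m] [CommRing R]
    (A : Matrix m m R) (k : ℕ) :
    (1 - (Polynomial.X : R[X]) • A.map Polynomial.C).adjugate.map (Polynomial.coeff · k) =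
      ∑ p ∈ Finset.HasAntidiagonal.antidiagonal k, A.charpolyRev.coeff p.2 • A ^ p.1 := by
  set B := (1 - (Polynomial.X : R[X]) • A.map Polynomial.C).adjugate with hB
  have h_mul : B = (Polynomial.X : R[X]) • (A.map Polynomial.C * B) + A.charpolyRev • 1 := by
    rw [charpolyRev, ← mul_adjugate, ← hB, sub_mul, one_mul, smul_mul]
    abel
  have h_entry (i j : m) :
      B i j = Polynomial.X * (A.map Polynomial.C * B) i j + A.charpolyRev * (1 : Matrix m m R[X]) i j :=
    congrFun (congrFun h_mul i) j
  induction k with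
  | zero =>
    ext i j
    rw [map_apply, h_entry]
    by_cases hij : i = j <;> simp [one_apply, hij]
  | succ k ih =>
    have h_step : B.map (Polynomial.coeff · (k + 1)) =
        A * B.map (Polynomial.coeff · k) + A.charpolyRev.coeff (k + 1) • 1 := by
      ext i j
      rw [map_apply, h_entry]
      by_cases hij : i = j <;> simp [one_apply, hij, mul_apply, Polynomial.finsetSum_coeff]
    rw [h_step, ih, Finset.Nat.sum_antidiagonal_succ, Finset.mul_sum, add_comm]
    simp [pow_succ']

/-- **Newton's identities** for the coefficients of the reversed characteristic polynomial. -/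
theorem succ_mul_coeff_charpolyRev {m R : Type*} [Fintype m] [DecidableEq m] [CommRing R]
    (A : Matrix m m R) (k : ℕ) :
    (k + 1 : R) * A.charpolyRev.coeff (k + 1) =
      -∑ p ∈ Finset.HasAntidiagonal.antidiagonal k, (A ^ (p.1 + 1)).trace * A.charpolyRev.coeff p.2 := by
  have h_deriv : (1 - (Polynomial.X : R[X]) • A.map Polynomial.C).map Polynomial.derivative = -A.map Polynomial.C := by
    ext1 i j
    by_cases hij : i = j <;> simp [hij]
  have h_coeff (B : Matrix m m R[X]) :
      (B * A.map Polynomial.C).trace.coeff k = (B.map (Polynomial.coeff · k) * A).trace := by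
    simp [trace, mul_apply, Polynomial.finsetSum_coeff]
  rw [mul_comm, ← Polynomial.coeff_derivative, charpolyRev, derivative_det_eq_trace, h_deriv, mul_neg,
    trace_neg, Polynomial.coeff_neg, h_coeff, map_coeff_adjugate_one_sub_X_smul, Finset.sum_mul, trace_sum]
  simp [pow_succ, charpolyRev, mul_comm]

end Matrix

theorem δ_X (k : ℕ) : δ (X k) = (k : MvPolynomial ℕ ℚ) * X (k + 1) := by
  simp [δ, mkDerivation_X]

theorem X_one_mul_sub_δ_smul_cauchyJ (k : ℕ) :
    X 1 * ((k.factorial : ℚ)⁻¹ • cauchyJ k) - δ ((k.factorial : ℚ)⁻¹ • cauchyJ k) =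
      (k + 1 : MvPolynomial ℕ ℚ) * (((k + 1).factorial : ℚ)⁻¹ • cauchyJ (k + 1)) := by
  have h_cast : (k + 1 : MvPolynomial ℕ ℚ) = C (k + 1 : ℚ) := by simp
  rw [Derivation.map_smul, mul_smul_comm, ← smul_sub, h_cast, ← smul_eq_C_mul, smul_smul, cauchyJ]
  congr 1
  have := k.factorial_ne_zero
  rw [Nat.factorial_succ]
  push_cast
  field_simp

/-- The normalized Cauchy polynomials satisfy **Newton's identities**. -/
theorem succ_mul_smul_cauchyJ (k : ℕ) :
    (k + 1 : MvPolynomial ℕ ℚ) * (((k + 1).factorial : ℚ)⁻¹ • cauchyJ (k + 1)) =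
      ∑ p ∈ Finset.HasAntidiagonal.antidiagonal k,
        (-1) ^ p.1 * X (p.1 + 1) * ((p.2.factorial : ℚ)⁻¹ • cauchyJ p.2) := by
  set e : ℕ → MvPolynomial ℕ ℚ := fun (k : ℕ) => (k.factorial : ℚ)⁻¹ • cauchyJ k with he
  have h_rec (k : ℕ) : X 1 * e k - δ (e k) = (k + 1 : MvPolynomial ℕ ℚ) * e (k + 1) :=
    X_one_mul_sub_δ_smul_cauchyJ k
  change (k + 1 : MvPolynomial ℕ ℚ) * e (k + 1) =
    ∑ p ∈ Finset.HasAntidiagonal.antidiagonal k, (-1) ^ p.1 * X (p.1 + 1) * e p.2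
  induction k with
  | zero => simp [he, cauchyJ]
  | succ k ih =>
    have h_ne : (k + 1 : MvPolynomial ℕ ℚ) ≠ 0 := by exact_mod_cast k.succ_ne_zero
    apply mul_left_cancel₀ h_ne
    have h_δ_cast : δ (k + 1 : MvPolynomial ℕ ℚ) = 0 := by
      simp
    have h_δ_sign (i : ℕ) : δ ((-1) ^ i : MvPolynomial ℕ ℚ) = 0 := by
      simp [Derivation.leibniz_pow]
    have h_term (i j : ℕ) : X 1 * ((-1) ^ i * X (i + 1) * e j) - δ ((-1) ^ i * X (i + 1) * e j) =
        (-1) ^ i * X (i + 1) * (((j + 1 : ℕ) : MvPolynomial ℕ ℚ) * e (j + 1)) +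
          ((i + 1 : ℕ) : MvPolynomial ℕ ℚ) * ((-1) ^ (i + 1) * X (i + 1 + 1) * e j) := by
      rw [Derivation.leibniz, Derivation.leibniz, h_δ_sign, δ_X]
      simp only [smul_eq_mul]
      push_cast
      rw [← h_rec j]
      ring
    calc (k + 1 : MvPolynomial ℕ ℚ) * ((((k + 1 : ℕ) : MvPolynomial ℕ ℚ) + 1) * e (k + 1 + 1))
        = X 1 * ((k + 1 : MvPolynomial ℕ ℚ) * e (k + 1)) -
            δ ((k + 1 : MvPolynomial ℕ ℚ) * e (k + 1)) := by
          rw [← h_rec (k + 1), Derivation.leibniz, h_δ_cast]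
          simp only [smul_eq_mul]
          ring
      _ = ∑ p ∈ Finset.HasAntidiagonal.antidiagonal k,
            ((-1) ^ p.1 * X (p.1 + 1) * (((p.2 + 1 : ℕ) : MvPolynomial ℕ ℚ) * e (p.2 + 1))) +
          ∑ p ∈ Finset.HasAntidiagonal.antidiagonal k, ((p.1 + 1 : ℕ) : MvPolynomial ℕ ℚ) *
            ((-1) ^ (p.1 + 1) * X (p.1 + 1 + 1) * e p.2) := by
          rw [ih, Finset.mul_sum, map_sum, ← Finset.sum_sub_distrib, ← Finset.sum_add_distrib]
          exact Finset.sum_congr rfl fun p _ => h_term p.1 p.2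
      _ = ∑ p ∈ Finset.HasAntidiagonal.antidiagonal (k + 1),
            ((-1) ^ p.1 * X (p.1 + 1) * ((p.2 : MvPolynomial ℕ ℚ) * e p.2)) +
          ∑ p ∈ Finset.HasAntidiagonal.antidiagonal (k + 1), (p.1 : MvPolynomial ℕ ℚ) *
            ((-1) ^ p.1 * X (p.1 + 1) * e p.2) := by
          rw [Finset.Nat.sum_antidiagonal_succ (n := k) (f := fun p : ℕ × ℕ =>
              (p.1 : MvPolynomial ℕ ℚ) * ((-1) ^ p.1 * X (p.1 + 1) * e p.2)),
            Finset.Nat.sum_antidiagonal_succ' (n := k)]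
          simp
      _ = _ := by
          rw [← Finset.sum_add_distrib, Finset.mul_sum]
          refine Finset.sum_congr rfl fun p hp => ?_
          have h_add : (k + 1 : MvPolynomial ℕ ℚ) = p.1 + p.2 := by
            exact_mod_cast (Finset.HasAntidiagonal.mem_antidiagonal.mp hp).symm
          rw [h_add]
          ring

theorem aeval_smul_cauchyJ_traces {n : ℕ} (A : Matrix (Fin n) (Fin n) ℚ) (k : ℕ) :
    aeval (fun i : ℕ => (A ^ i).trace) ((k.factorial : ℚ)⁻¹ • cauchyJ k) =
      (-1) ^ k * A.charpolyRev.coeff k := by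
  induction k using Nat.strong_induction_on with
  | _ k ih =>
    cases k with
    | zero => simp [cauchyJ, Polynomial.coeff_zero_eq_eval_zero]
    | succ k =>
      have h_ne : (k + 1 : ℚ) ≠ 0 := by positivity
      apply mul_left_cancel₀ h_ne
      have h_newton := congrArg (aeval fun i : ℕ => (A ^ i).trace) (succ_mul_smul_cauchyJ k)
      simp only [map_mul, map_add, map_natCast, map_one, map_sum, map_pow, map_neg,
        aeval_X] at h_newton
      rw [h_newton, mul_left_comm, A.succ_mul_coeff_charpolyRev, mul_neg, ← neg_mul,
        Finset.mul_sum]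
      refine Finset.sum_congr rfl fun p hp => ?_
      have h_add := Finset.HasAntidiagonal.mem_antidiagonal.mp hp
      rw [ih p.2 (by lia), ← h_add]
      ring

/-- Evaluating the Cauchy polynomial `jₖ` at `xᵢ = Tr (Aⁱ)` gives `k!` times the `k`-th
prodeterminant of `A`:  `k! · Jₖ(A) = jₖ (I₁, …, Iₖ)`. -/
theorem factorial_prodet_eq_cauchyJ_traces (n k : ℕ) (hk : 1 ≤ k) (hkn : k ≤ n)
    (A : Matrix (Fin n) (Fin n) ℚ) :
    (k.factorial : ℚ) * prodet A k =
      aeval (fun i : ℕ => (A ^ i).trace) (cauchyJ k) := by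
  have h_coeff : A.charpoly.coeff (n - k) = A.charpolyRev.coeff k := by
    rw [← Matrix.reverse_charpoly, Polynomial.coeff_reverse, Matrix.charpoly_natDegree_eq_dim,
      Fintype.card_fin, Polynomial.revAt_le hkn]
  rw [prodet, h_coeff, ← aeval_smul_cauchyJ_traces, map_smul, smul_eq_mul,
    mul_inv_cancel_left₀ (by exact_mod_cast k.factorial_ne_zero)]
end

section
/- Let n ≥ 1 and let α be a partition symbol of n. The coefficient of the monomial ∏_i x_i^{α(i)} in the polynomial k_n = (x_1 + δ)^{n−1} x_1 equals the number of permutations of {1, …, n} whose cycle decomposition contains exactly α(i) cycles of length i for every i ≥ 1 (fixed points counted as cycles of length 1), i.e. the cardinality of the conjugacy class of the symmetric group S_n labelled by α. -/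
open MvPolynomial

/-- The complementary polynomials: `k 1 = x₁` and `k (i+1) = x₁ · k i + δ (k i)`,
i.e. `kₙ = (x₁ + δ)^(n−1) x₁`. -/
noncomputable def cauchyK : ℕ → MvPolynomial ℕ ℚ
  | 0 => 1
  | i + 1 => X 1 * cauchyK i + δ (cauchyK i)

/-- The full cycle type of a permutation of `Fin n`: the multiset of the lengths of all its
cycles, where each fixed point is counted as a cycle of length `1`. -/
def fullCycleType {n : ℕ} (σ : Equiv.Perm (Fin n)) : Multiset ℕ :=
  σ.cycleType + Multiset.replicate (Finset.univ.filter fun x => σ x = x).card 1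

/-- The order of the centralizer of a permutation with `α i` cycles of length `i`. -/
noncomputable def centralizerOrder (α : ℕ →₀ ℕ) : ℕ :=
  α.prod fun i a => i ^ a * a.factorial

theorem centralizerOrder_add_single (γ : ℕ →₀ ℕ) (i : ℕ) :
    centralizerOrder (γ + Finsupp.single i 1) = centralizerOrder γ * (i * (γ i + 1)) := by
  classical
  unfold centralizerOrder
  have h1 : ∀ β : ℕ →₀ ℕ, β.support ⊆ insert i γ.support →
      (β.prod fun i a => i ^ a * a.factorial) =
        ∏ j ∈ insert i γ.support, j ^ β j * (β j).factorial :=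
    fun β hβ => Finsupp.prod_of_support_subset _ hβ _ (by simp)
  rw [h1 γ (Finset.subset_insert _ _), h1 (γ + Finsupp.single i 1)
    (Finsupp.support_add.trans (by
      intro j hj
      rcases Finset.mem_union.1 hj with h | h
      · exact Finset.mem_insert_of_mem h
      · have := Finsupp.support_single_subset h
        simp_all))]
  rw [← Finset.mul_prod_erase _ _ (Finset.mem_insert_self i γ.support),
    ← Finset.mul_prod_erase _ (fun j => j ^ γ j * (γ j).factorial)
      (Finset.mem_insert_self i γ.support)]
  have h2 : ∀ j ∈ (insert i γ.support).erase i,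
      j ^ (γ + Finsupp.single i 1 : ℕ →₀ ℕ) j *
        ((γ + Finsupp.single i 1 : ℕ →₀ ℕ) j).factorial =
        j ^ γ j * (γ j).factorial := by
    intro j hj
    simp [(Finset.ne_of_mem_erase hj).symm]
  rw [Finset.prod_congr rfl h2]
  simp only [Finsupp.add_apply, Finsupp.single_eq_same, Nat.factorial_succ, pow_succ]
  ring

theorem Finsupp.exists_eq_add_single_of_ne_zero {α : ℕ →₀ ℕ} {i : ℕ} (h : α i ≠ 0) :
    ∃ γ : ℕ →₀ ℕ, α = γ + Finsupp.single i 1 :=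
  ⟨α - Finsupp.single i 1, (tsub_add_cancel_of_le
    (Finsupp.single_le_iff.2 (Nat.one_le_iff_ne_zero.2 h))).symm⟩

theorem δ_monomial (β : ℕ →₀ ℕ) (r : ℚ) :
    δ (monomial β r) = ∑ k ∈ β.support,
      monomial (β - Finsupp.single k 1 + Finsupp.single (k + 1) 1) (r * β k * k) := by
  rw [δ, mkDerivation_monomial, Finsupp.sum, Finset.smul_sum]
  refine Finset.sum_congr rfl fun k _ => ?_
  have : (k : MvPolynomial ℕ ℚ) * X (k + 1) = monomial (Finsupp.single (k + 1) 1) (k : ℚ) := by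
    rw [← C_mul_X_eq_monomial, map_natCast]
  rw [this, smul_eq_mul, monomial_mul, smul_monomial, smul_eq_mul, mul_assoc]

theorem coeff_δ (α : ℕ →₀ ℕ) (N : ℕ) (hN : ∀ k, α (k + 1) ≠ 0 → k < N)
    (p : MvPolynomial ℕ ℚ) :
    coeff α (δ p) = ∑ k ∈ Finset.range N, if α (k + 1) = 0 then 0 else
      k * (α k + 1) * coeff (α - Finsupp.single (k + 1) 1 + Finsupp.single k 1) p := by
  classical
  induction p using MvPolynomial.induction_on' with
  | add p q hp hq =>
    rw [map_add, coeff_add, hp, hq, ← Finset.sum_add_distrib]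
    refine Finset.sum_congr rfl fun k _ => ?_
    split_ifs <;> simp [mul_add]
  | monomial β r =>
    rw [δ_monomial, coeff_sum]
    simp only [coeff_monomial]
    have key : ∀ k, (if β k = 0 then 0 else
        if β - Finsupp.single k 1 + Finsupp.single (k + 1) 1 = α then r * β k * k else 0) =
        if α (k + 1) = 0 then 0 else (k * (α k + 1) *
        if β = α - Finsupp.single (k + 1) 1 + Finsupp.single k 1 then r else 0 : ℚ) := by
      intro k
      by_cases hα : α (k + 1) = 0
      · rw [if_pos hα]
        split_ifs with h1 h2
        · rfl
        · rw [← h2] at hα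
          simp at hα
        · rfl
      · obtain ⟨γ, rfl⟩ := Finsupp.exists_eq_add_single_of_ne_zero hα
        rw [if_neg hα, add_tsub_cancel_right]
        by_cases hβ : β k = 0
        · rw [if_pos hβ, if_neg, mul_zero]
          rintro rfl
          simp at hβ
        · obtain ⟨ε, rfl⟩ := Finsupp.exists_eq_add_single_of_ne_zero hβ
          rw [if_neg hβ, add_tsub_cancel_right]
          simp only [add_left_inj]
          split_ifs with h
          · subst h
            simp
            ring
          · simp
    rw [← Finset.sum_congr rfl fun k _ => key k]
    trans ∑ k ∈ β.support ∪ Finset.range N, if β k = 0 then 0 else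
        if β - Finsupp.single k 1 + Finsupp.single (k + 1) 1 = α then r * β k * k else 0
    · rw [← Finset.sum_subset Finset.subset_union_left fun k _ hk => ?_]
      · exact Finset.sum_congr rfl fun k hk => (if_neg (Finsupp.mem_support_iff.1 hk)).symm
      · exact if_pos (Finsupp.notMem_support_iff.1 hk)
    · refine (Finset.sum_subset Finset.subset_union_right fun k _ hk => ?_).symm
      rw [key, if_pos]
      by_contra h
      exact hk (Finset.mem_range.2 (hN k h))

theorem coeff_cauchyK_mul_centralizerOrder (n : ℕ) (α : ℕ →₀ ℕ) (h0 : α 0 = 0)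
    (hα : (α.sum fun i a => i * a) = n) :
    coeff α (cauchyK n) * centralizerOrder α = n.factorial := by
  classical
  induction n generalizing α with
  | zero =>
    have : α = 0 := by
      ext i
      by_contra hi
      have hi' : α i ≠ 0 := hi
      have := (Finset.sum_eq_zero_iff.1 hα) i (Finsupp.mem_support_iff.2 hi')
      rcases Nat.mul_eq_zero.1 this with h | h
      · exact hi' (h ▸ h0)
      · exact hi' h
    subst this
    simp [cauchyK, centralizerOrder]
  | succ n ih =>
    have hsum : ∀ (γ : ℕ →₀ ℕ) (i : ℕ), ((γ + Finsupp.single i 1).sum fun i a => i * a) =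
        (γ.sum fun i a => i * a) + i := by
      intro γ i
      rw [Finsupp.sum_add_index' (by simp) (by intros; ring)]
      simp
    obtain ⟨N, hN⟩ : ∃ N, ∀ k, α k ≠ 0 → k < N :=
      ⟨α.support.sup id + 1, fun k hk => Nat.lt_succ_of_le
        (Finset.le_sup (f := id) (Finsupp.mem_support_iff.2 hk))⟩
    have hX : coeff α (X 1 * cauchyK n) * centralizerOrder α = n.factorial * (α 1 : ℚ) := by
      rw [coeff_X_mul']
      split_ifs with h
      · obtain ⟨γ, rfl⟩ := Finsupp.exists_eq_add_single_of_ne_zero (Finsupp.mem_support_iff.1 h)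
        rw [add_tsub_cancel_right, centralizerOrder_add_single,
          ← ih γ (by simpa using h0) (by have := hsum γ 1; omega)]
        simp
        ring
      · simp [Finsupp.notMem_support_iff.1 h]
    have hterm : ∀ k, (if α (k + 1) = 0 then 0 else
        k * (α k + 1) * coeff (α - Finsupp.single (k + 1) 1 + Finsupp.single k 1) (cauchyK n) : ℚ)
          * centralizerOrder α = n.factorial * (if k = 0 then 0 else ((k + 1) * α (k + 1) : ℚ)) := by
      intro k
      rcases Nat.eq_zero_or_pos k with rfl | hk
      · simp
      rw [if_neg hk.ne']
      split_ifs with h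
      · simp [h]
      · obtain ⟨γ, rfl⟩ := Finsupp.exists_eq_add_single_of_ne_zero h
        rw [add_tsub_cancel_right, centralizerOrder_add_single,
          ← ih (γ + Finsupp.single k 1) (by simpa [hk.ne'] using h0)
            (by have := hsum γ (k + 1); have := hsum γ k; omega), centralizerOrder_add_single]
        simp
        ring
    have hw : (∑ i ∈ Finset.range (N + 1), (i : ℚ) * α i) = n + 1 := by
      have : (∑ i ∈ Finset.range (N + 1), i * α i) = n + 1 := by
        rw [← hα]
        refine (Finsupp.sum_of_support_subset _ (fun i hi => ?_) _ (by simp)).symm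
        have := hN i (Finsupp.mem_support_iff.1 hi)
        simp
        omega
      exact_mod_cast this
    rw [cauchyK, coeff_add, add_mul, hX,
      coeff_δ α N (fun k hk => (Nat.lt_succ_self k).trans (hN _ hk)), Finset.sum_mul,
      Finset.sum_congr rfl fun k _ => hterm k, ← Finset.mul_sum, ← mul_add, Nat.factorial_succ]
    push_cast
    rw [← hw, Finset.sum_range_succ', mul_comm]
    congr 1
    rcases N with _ | N
    · have : α 1 = 0 := by by_contra h; exact absurd (hN 1 h) (by simp)
      simp [this]
    · rw [Finset.sum_range_succ', Finset.sum_range_succ' _ N]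
      simp
      ring

theorem sum_toMultiset_erase_one_add (α : ℕ →₀ ℕ) :
    (Finsupp.toMultiset (α.erase 1)).sum + α 1 = α.sum fun i a => i * a := by
  rw [← Finsupp.add_sum_erase' α 1 (fun i a => i * a) (by simp), Finsupp.toMultiset_apply,
    Finsupp.sum, Multiset.sum_sum, Finsupp.sum]
  simp [Multiset.sum_nsmul, mul_comm, add_comm]

theorem centralizerOrder_eq_toMultiset_erase_one (α : ℕ →₀ ℕ) :
    centralizerOrder α = (α 1).factorial * (Finsupp.toMultiset (α.erase 1)).prod *
      ∏ i ∈ (Finsupp.toMultiset (α.erase 1)).toFinset,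
        ((Finsupp.toMultiset (α.erase 1)).count i).factorial := by
  rw [centralizerOrder, ← Finsupp.mul_prod_erase' α 1 _ (by simp), Finsupp.prod_toMultiset,
    Finsupp.toFinset_toMultiset, Finsupp.prod, Finsupp.prod, Finset.prod_mul_distrib]
  simp only [Finsupp.count_toMultiset, one_pow, one_mul, mul_assoc]

theorem card_fixed_add_sum_cycleType {n : ℕ} (σ : Equiv.Perm (Fin n)) :
    (Finset.univ.filter fun x => σ x = x).card + σ.cycleType.sum = n := by
  rw [Equiv.Perm.sum_cycleType, Equiv.Perm.support,
    Finset.card_filter_add_card_filter_not, Finset.card_univ, Fintype.card_fin]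

theorem count_fullCycleType_eq_iff {n : ℕ} (α : ℕ →₀ ℕ)
    (hα : (α.sum fun i a => i * a) = n) (σ : Equiv.Perm (Fin n)) :
    (∀ i : ℕ, (fullCycleType σ).count i = α i) ↔
      σ.cycleType = Finsupp.toMultiset (α.erase 1) := by
  have h1 : σ.cycleType.count 1 = 0 :=
    Multiset.count_eq_zero.2 fun h => absurd (Equiv.Perm.two_le_of_mem_cycleType h) (by simp)
  simp only [fullCycleType, Multiset.count_add, Multiset.count_replicate]
  constructor
  · intro h
    ext i
    rw [Finsupp.count_toMultiset]
    rcases eq_or_ne i 1 with rfl | hi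
    · rw [h1, Finsupp.erase_same]
    · rw [Finsupp.erase_ne hi, ← h i, if_neg hi.symm, add_zero]
  · intro h i
    rcases eq_or_ne i 1 with rfl | hi
    · have hfix := card_fixed_add_sum_cycleType σ
      have hsum := sum_toMultiset_erase_one_add α
      rw [h] at hfix
      rw [h1, if_pos rfl]
      omega
    · rw [h, Finsupp.count_toMultiset, Finsupp.erase_ne hi, if_neg hi.symm, add_zero]

theorem card_fullCycleType_mul_centralizerOrder {n : ℕ} (α : ℕ →₀ ℕ) (h0 : α 0 = 0)
    (hα : (α.sum fun i a => i * a) = n) :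
    Nat.card {σ : Equiv.Perm (Fin n) // ∀ i : ℕ, (fullCycleType σ).count i = α i} *
      centralizerOrder α = n.factorial := by
  have hsum := sum_toMultiset_erase_one_add α
  have htwo : ∀ a ∈ Finsupp.toMultiset (α.erase 1), 2 ≤ a := by
    intro a ha
    rw [Finsupp.mem_toMultiset, Finsupp.support_erase, Finset.mem_erase,
      Finsupp.mem_support_iff] at ha
    have : a ≠ 0 := by
      rintro rfl
      exact ha.2 h0
    omega
  have hcard := Equiv.Perm.card_of_cycleType_mul_eq (Fin n) (Finsupp.toMultiset (α.erase 1))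
  rw [Fintype.card_fin, if_pos ⟨by omega, htwo⟩,
    show n - (Finsupp.toMultiset (α.erase 1)).sum = α 1 by omega,
    ← centralizerOrder_eq_toMultiset_erase_one] at hcard
  simp_rw [count_fullCycleType_eq_iff α hα]
  rw [Nat.card_eq_fintype_card, Fintype.card_subtype, hcard]

/-- For a partition symbol `α` of `n`, the coefficient of `∏ i, xᵢ ^ α i` in
`kₙ = (x₁ + δ)^(n−1) x₁` is the number of permutations of `{1, …, n}` having exactly `α i`
cycles of length `i` for every `i` (fixed points counted as cycles of length `1`), i.e. the
cardinality of the conjugacy class of `Sₙ` labelled by `α`. -/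
theorem coeff_cauchyK_eq_card_conjugacy_class (n : ℕ) (hn : 1 ≤ n) (α : ℕ →₀ ℕ)
    (h0 : α 0 = 0) (hα : (α.sum fun i a => i * a) = n) :
    coeff α (cauchyK n) =
      (Nat.card {σ : Equiv.Perm (Fin n) // ∀ i : ℕ, (fullCycleType σ).count i = α i} : ℚ) := by
  have hcard := card_fullCycleType_mul_centralizerOrder α h0 hα
  have hz : (centralizerOrder α : ℚ) ≠ 0 := by
    intro h
    rw [Nat.cast_eq_zero.1 h, mul_zero] at hcard
    exact n.factorial_ne_zero hcard.symm
  refine mul_right_cancel₀ hz ?_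
  rw [coeff_cauchyK_mul_centralizerOrder n α h0 hα, ← hcard, Nat.cast_mul]
end
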